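/- Suppose the three reduced field equations hold on D: (EAa) ∂₁²F' + ∂₃²F' + (1/Π)(∂₁F'·∂₁Π + ∂₃F'·∂₃Π) + (e^{4F'}/(2Π²))·[(∂₁A')² + (∂₃A')²] = (4πG/c⁴)·e^{−2F'+2K'}·(c²ρ + 3P); (EAb) ∂₁((e^{4F'}/Π)·∂₁A') + ∂₃((e^{4F'}/Π)·∂₃A') = 0; (EAc) ∂₁²Π + ∂₃²Π = (16πG/c⁴)·e^{−2F'+2K'}·P·Π. Then the three Einstein equations R₀₀ = (8πG/c⁴)·𝔗₀₀, R₀₂ = (8πG/c⁴)·𝔗₀₂ and R₂₂ = (8πG/c⁴)·𝔗₂₂ hold on D. -/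

import Mathlib

open Real

/-- Partial derivative with respect to the first coordinate ϖ. -/
noncomputable def pd1 (f : ℝ × ℝ → ℝ) (x : ℝ × ℝ) : ℝ := fderiv ℝ f x (1, 0)

/-- Partial derivative with respect to the second coordinate z. -/
noncomputable def pd3 (f : ℝ × ℝ → ℝ) (x : ℝ × ℝ) : ℝ := fderiv ℝ f x (0, 1)

/-- f' = f − 2(Ω/c)k − (Ω²/c²)l. -/
noncomputable def fP (Ω c : ℝ) (f k l : ℝ × ℝ → ℝ) (x : ℝ × ℝ) : ℝ :=
  f x - 2 * (Ω / c) * k x - (Ω ^ 2 / c ^ 2) * l x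

/-- Π = √(f·l + k²). -/
noncomputable def PiF (f k l : ℝ × ℝ → ℝ) (x : ℝ × ℝ) : ℝ :=
  Real.sqrt (f x * l x + (k x) ^ 2)

/-- k' = k + (Ω/c)l. -/
noncomputable def kP (Ω c : ℝ) (k l : ℝ × ℝ → ℝ) (x : ℝ × ℝ) : ℝ :=
  k x + (Ω / c) * l x

/-- F' = ½ log f'. -/
noncomputable def FP (Ω c : ℝ) (f k l : ℝ × ℝ → ℝ) (x : ℝ × ℝ) : ℝ :=
  (1 / 2) * Real.log (fP Ω c f k l x)

/-- A' = −k'/f'. -/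
noncomputable def AP (Ω c : ℝ) (f k l : ℝ × ℝ → ℝ) (x : ℝ × ℝ) : ℝ :=
  -(kP Ω c k l x) / fP Ω c f k l x

/-- K' = F' + m/2. -/
noncomputable def KP (Ω c : ℝ) (f k l m : ℝ × ℝ → ℝ) (x : ℝ × ℝ) : ℝ :=
  FP Ω c f k l x + m x / 2

/-- Σ = ∂₁f·∂₁l + ∂₃f·∂₃l + (∂₁k)² + (∂₃k)². -/
noncomputable def SigF (f k l : ℝ × ℝ → ℝ) (x : ℝ × ℝ) : ℝ :=
  pd1 f x * pd1 l x + pd3 f x * pd3 l x + (pd1 k x) ^ 2 + (pd3 k x) ^ 2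

/-- Ricci component R₀₀ of the Lewis metric. -/
noncomputable def R00 (f k l m : ℝ × ℝ → ℝ) (x : ℝ × ℝ) : ℝ :=
  (PiF f k l x * Real.exp (-(m x)) / 2) *
    (pd1 (fun y => pd1 f y / PiF f k l y) x + pd3 (fun y => pd3 f y / PiF f k l y) x
      + f x * SigF f k l x / (PiF f k l x) ^ 3)

/-- Ricci component R₀₂ of the Lewis metric. -/
noncomputable def R02 (f k l m : ℝ × ℝ → ℝ) (x : ℝ × ℝ) : ℝ :=
  -((PiF f k l x * Real.exp (-(m x)) / 2) *
    (pd1 (fun y => pd1 k y / PiF f k l y) x + pd3 (fun y => pd3 k y / PiF f k l y) x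
      + k x * SigF f k l x / (PiF f k l x) ^ 3))

/-- Ricci component R₂₂ of the Lewis metric. -/
noncomputable def R22 (f k l m : ℝ × ℝ → ℝ) (x : ℝ × ℝ) : ℝ :=
  -((PiF f k l x * Real.exp (-(m x)) / 2) *
    (pd1 (fun y => pd1 l y / PiF f k l y) x + pd3 (fun y => pd3 l y / PiF f k l y) x
      + l x * SigF f k l x / (PiF f k l x) ^ 3))

/-- Ricci component R₁₁ of the Lewis metric. -/
noncomputable def R11 (f k l m : ℝ × ℝ → ℝ) (x : ℝ × ℝ) : ℝ :=
  (1 / 2) * (-(pd1 (pd1 m) x) - pd3 (pd3 m) x - 2 * pd1 (pd1 (PiF f k l)) x / PiF f k l x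
    + (1 / PiF f k l x) * (pd1 m x * pd1 (PiF f k l) x - pd3 m x * pd3 (PiF f k l) x)
    + (1 / (PiF f k l x) ^ 2) * (pd1 f x * pd1 l x + (pd1 k x) ^ 2))

/-- Ricci component R₃₃ of the Lewis metric. -/
noncomputable def R33 (f k l m : ℝ × ℝ → ℝ) (x : ℝ × ℝ) : ℝ :=
  (1 / 2) * (-(pd1 (pd1 m) x) - pd3 (pd3 m) x - 2 * pd3 (pd3 (PiF f k l)) x / PiF f k l x
    - (1 / PiF f k l x) * (pd1 m x * pd1 (PiF f k l) x - pd3 m x * pd3 (PiF f k l) x)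
    + (1 / (PiF f k l x) ^ 2) * (pd3 f x * pd3 l x + (pd3 k x) ^ 2))

/-- Ricci component R₁₃ of the Lewis metric. -/
noncomputable def R13 (f k l m : ℝ × ℝ → ℝ) (x : ℝ × ℝ) : ℝ :=
  (1 / 2) * (-(2 * pd1 (pd3 (PiF f k l)) x / PiF f k l x)
    + (1 / PiF f k l x) * (pd3 m x * pd1 (PiF f k l) x + pd1 m x * pd3 (PiF f k l) x)
    + (1 / (2 * (PiF f k l x) ^ 2)) *
        (pd1 f x * pd3 l x + pd1 l x * pd3 f x + 2 * pd1 k x * pd3 k x))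

/-- 𝔗₀₀ component of T_{μν} − ½ g_{μν} T. -/
noncomputable def T00 (Ω c : ℝ) (f k l ρ P : ℝ × ℝ → ℝ) (x : ℝ × ℝ) : ℝ :=
  (1 / 2) * (c ^ 2 * ρ x + P x) * (1 / fP Ω c f k l x) *
    ((f x - (Ω / c) * k x) ^ 2 + (Ω ^ 2 / c ^ 2) * (PiF f k l x) ^ 2) + P x * f x

/-- 𝔗₀₂ component of T_{μν} − ½ g_{μν} T. -/
noncomputable def T02 (Ω c : ℝ) (f k l ρ P : ℝ × ℝ → ℝ) (x : ℝ × ℝ) : ℝ :=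
  (1 / 2) * (c ^ 2 * ρ x + P x) * (1 / fP Ω c f k l x) *
    (-(k x * f x) - 2 * (Ω / c) * f x * l x + (Ω ^ 2 / c ^ 2) * k x * l x) - P x * k x

/-- 𝔗₂₂ component of T_{μν} − ½ g_{μν} T. -/
noncomputable def T22 (Ω c : ℝ) (f k l ρ P : ℝ × ℝ → ℝ) (x : ℝ × ℝ) : ℝ :=
  (1 / 2) * (c ^ 2 * ρ x + P x) * (1 / fP Ω c f k l x) *
    ((PiF f k l x) ^ 2 + (k x + (Ω / c) * l x) ^ 2) - P x * l x

/-- Equation (EAa) at a point. -/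
noncomputable def EAa (Ω c G : ℝ) (f k l m ρ P : ℝ × ℝ → ℝ) (x : ℝ × ℝ) : Prop :=
  pd1 (pd1 (FP Ω c f k l)) x + pd3 (pd3 (FP Ω c f k l)) x
    + (1 / PiF f k l x) * (pd1 (FP Ω c f k l) x * pd1 (PiF f k l) x
        + pd3 (FP Ω c f k l) x * pd3 (PiF f k l) x)
    + (Real.exp (4 * FP Ω c f k l x) / (2 * (PiF f k l x) ^ 2)) *
        ((pd1 (AP Ω c f k l) x) ^ 2 + (pd3 (AP Ω c f k l) x) ^ 2)
    = (4 * π * G / c ^ 4) * Real.exp (-2 * FP Ω c f k l x + 2 * KP Ω c f k l m x) *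
        (c ^ 2 * ρ x + 3 * P x)

/-- Equation (EAb) at a point. -/
noncomputable def EAb (Ω c : ℝ) (f k l : ℝ × ℝ → ℝ) (x : ℝ × ℝ) : Prop :=
  pd1 (fun y => (Real.exp (4 * FP Ω c f k l y) / PiF f k l y) * pd1 (AP Ω c f k l) y) x
    + pd3 (fun y => (Real.exp (4 * FP Ω c f k l y) / PiF f k l y) * pd3 (AP Ω c f k l) y) x
    = 0

/-- Equation (EAc) at a point. -/
noncomputable def EAc (Ω c G : ℝ) (f k l m P : ℝ × ℝ → ℝ) (x : ℝ × ℝ) : Prop :=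
  pd1 (pd1 (PiF f k l)) x + pd3 (pd3 (PiF f k l)) x
    = (16 * π * G / c ^ 4) * Real.exp (-2 * FP Ω c f k l x + 2 * KP Ω c f k l m x) *
        P x * PiF f k l x

/-- Equation (ECd) at a point. -/
noncomputable def ECd (Ω c : ℝ) (f k l m : ℝ × ℝ → ℝ) (x : ℝ × ℝ) : Prop :=
  pd1 (PiF f k l) x * pd1 (KP Ω c f k l m) x - pd3 (PiF f k l) x * pd3 (KP Ω c f k l m) x
    = (1 / 2) * (pd1 (pd1 (PiF f k l)) x - pd3 (pd3 (PiF f k l)) x)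
      + PiF f k l x * ((pd1 (FP Ω c f k l) x) ^ 2 - (pd3 (FP Ω c f k l) x) ^ 2)
      - (Real.exp (4 * FP Ω c f k l x) / (4 * PiF f k l x)) *
          ((pd1 (AP Ω c f k l) x) ^ 2 - (pd3 (AP Ω c f k l) x) ^ 2)

/-- Equation (ECe) at a point. -/
noncomputable def ECe (Ω c : ℝ) (f k l m : ℝ × ℝ → ℝ) (x : ℝ × ℝ) : Prop :=
  pd3 (PiF f k l) x * pd1 (KP Ω c f k l m) x + pd1 (PiF f k l) x * pd3 (KP Ω c f k l m) x
    = pd1 (pd3 (PiF f k l)) x + 2 * PiF f k l x * pd1 (FP Ω c f k l) x * pd3 (FP Ω c f k l) x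
      - (Real.exp (4 * FP Ω c f k l x) / (2 * PiF f k l x)) *
          pd1 (AP Ω c f k l) x * pd3 (AP Ω c f k l) x

section DirectionalDerivative

variable {D : Set (ℝ × ℝ)} {u w h : ℝ × ℝ → ℝ} {x v : ℝ × ℝ}

/-- Directional derivatives of a smooth function on an open set are smooth. -/
lemma contDiffOn_fderiv_apply (hD : IsOpen D) (hu : ContDiffOn ℝ (⊤ : ℕ∞) u D) (v : ℝ × ℝ) :
    ContDiffOn ℝ (⊤ : ℕ∞) (fun y => fderiv ℝ u y v) D :=
  (hu.fderiv_of_isOpen hD (by norm_cast)).clm_apply contDiffOn_const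

lemma ContDiffOn.differentiableAt_of_isOpen (hD : IsOpen D) (hu : ContDiffOn ℝ (⊤ : ℕ∞) u D)
    (hx : x ∈ D) : DifferentiableAt ℝ u x :=
  (hu.contDiffAt (hD.mem_nhds hx)).differentiableAt (by simp)

lemma fderiv_apply_congr_of_isOpen (hD : IsOpen D) (huw : ∀ y ∈ D, u y = w y) (hx : x ∈ D)
    (v : ℝ × ℝ) : fderiv ℝ u x v = fderiv ℝ w x v := by
  rw [Filter.EventuallyEq.fderiv_eq (Filter.eventuallyEq_of_mem (hD.mem_nhds hx) huw)]

lemma fderiv_mul_apply (hu : DifferentiableAt ℝ u x) (hw : DifferentiableAt ℝ w x) (v : ℝ × ℝ) :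
    fderiv ℝ (fun y => u y * w y) x v = u x * fderiv ℝ w x v + fderiv ℝ u x v * w x := by
  rw [fderiv_fun_mul hu hw]
  simp [mul_comm]

/-- The product rule for a factorisation valid on an open set. -/
lemma fderiv_apply_of_mul_eq (hD : IsOpen D) (hu : ContDiffOn ℝ (⊤ : ℕ∞) u D)
    (hw : ContDiffOn ℝ (⊤ : ℕ∞) w D) (heq : ∀ y ∈ D, u y * w y = h y) (hx : x ∈ D) (v : ℝ × ℝ) :
    u x * fderiv ℝ w x v + fderiv ℝ u x v * w x = fderiv ℝ h x v := by
  rw [← fderiv_mul_apply (hu.differentiableAt_of_isOpen hD hx)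
    (hw.differentiableAt_of_isOpen hD hx), fderiv_apply_congr_of_isOpen hD heq hx]

lemma fderiv_linear_combination_apply {u₁ u₂ u₃ : ℝ × ℝ → ℝ} (h₁ : DifferentiableAt ℝ u₁ x)
    (h₂ : DifferentiableAt ℝ u₂ x) (h₃ : DifferentiableAt ℝ u₃ x) (a b : ℝ) (v : ℝ × ℝ) :
    fderiv ℝ (fun y => u₁ y + a * u₂ y + b * u₃ y) x v
      = fderiv ℝ u₁ x v + a * fderiv ℝ u₂ x v + b * fderiv ℝ u₃ x v := by
  rw [fderiv_fun_add (h₁.fun_add (h₂.const_mul a)) (h₃.const_mul b),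
    fderiv_fun_add h₁ (h₂.const_mul a), fderiv_const_mul h₂, fderiv_const_mul h₃]
  simp

/-- First and second directional derivatives of a linear combination. -/
lemma fderiv_fderiv_linear_combination_apply (hD : IsOpen D) {u₁ u₂ u₃ : ℝ × ℝ → ℝ}
    (h₁ : ContDiffOn ℝ (⊤ : ℕ∞) u₁ D) (h₂ : ContDiffOn ℝ (⊤ : ℕ∞) u₂ D)
    (h₃ : ContDiffOn ℝ (⊤ : ℕ∞) u₃ D) (a b : ℝ)
    (heq : ∀ y ∈ D, u y = u₁ y + a * u₂ y + b * u₃ y) (hx : x ∈ D) (v : ℝ × ℝ) :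
    fderiv ℝ u x v = fderiv ℝ u₁ x v + a * fderiv ℝ u₂ x v + b * fderiv ℝ u₃ x v ∧
    fderiv ℝ (fun y => fderiv ℝ u y v) x v = fderiv ℝ (fun y => fderiv ℝ u₁ y v) x v
      + a * fderiv ℝ (fun y => fderiv ℝ u₂ y v) x v
      + b * fderiv ℝ (fun y => fderiv ℝ u₃ y v) x v := by
  have key : ∀ y ∈ D, fderiv ℝ u y v
      = fderiv ℝ u₁ y v + a * fderiv ℝ u₂ y v + b * fderiv ℝ u₃ y v := fun y hy => by
    rw [fderiv_apply_congr_of_isOpen hD heq hy, fderiv_linear_combination_apply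
      (h₁.differentiableAt_of_isOpen hD hy) (h₂.differentiableAt_of_isOpen hD hy)
      (h₃.differentiableAt_of_isOpen hD hy)]
  refine ⟨key x hx, ?_⟩
  rw [fderiv_apply_congr_of_isOpen hD key hx, fderiv_linear_combination_apply
    ((contDiffOn_fderiv_apply hD h₁ v).differentiableAt_of_isOpen hD hx)
    ((contDiffOn_fderiv_apply hD h₂ v).differentiableAt_of_isOpen hD hx)
    ((contDiffOn_fderiv_apply hD h₃ v).differentiableAt_of_isOpen hD hx)]

/-- Quotient rule for smooth functions on an open set, with positive denominator. -/
lemma fderiv_div_apply_of_isOpen (hD : IsOpen D) (hu : ContDiffOn ℝ (⊤ : ℕ∞) u D)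
    (hw : ContDiffOn ℝ (⊤ : ℕ∞) w D) (hw0 : ∀ y ∈ D, 0 < w y) (hx : x ∈ D) (v : ℝ × ℝ) :
    fderiv ℝ (fun y => u y / w y) x v
      = fderiv ℝ u x v / w x - u x * fderiv ℝ w x v / w x ^ 2 := by
  have hq : ContDiffOn ℝ (⊤ : ℕ∞) (fun y => u y / w y) D := hu.div hw fun y hy => (hw0 y hy).ne'
  have := fderiv_apply_of_mul_eq hD hq hw (fun y hy => div_mul_cancel₀ _ (hw0 y hy).ne') hx v
  have h0 := (hw0 x hx).ne'
  field_simp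
  field_simp at this
  linarith

/-- First and second directional derivatives of the relation `p ^ 2 = u * w + h ^ 2`. -/
lemma fderiv_fderiv_of_sq_eq (hD : IsOpen D) {p : ℝ × ℝ → ℝ} (hp : ContDiffOn ℝ (⊤ : ℕ∞) p D)
    (hu : ContDiffOn ℝ (⊤ : ℕ∞) u D) (hw : ContDiffOn ℝ (⊤ : ℕ∞) w D)
    (hh : ContDiffOn ℝ (⊤ : ℕ∞) h D) (heq : ∀ y ∈ D, p y ^ 2 = u y * w y + h y ^ 2)
    (hx : x ∈ D) (v : ℝ × ℝ) :
    2 * p x * fderiv ℝ p x v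
      = fderiv ℝ u x v * w x + u x * fderiv ℝ w x v + 2 * h x * fderiv ℝ h x v ∧
    2 * fderiv ℝ p x v ^ 2 + 2 * p x * fderiv ℝ (fun y => fderiv ℝ p y v) x v
      = fderiv ℝ (fun y => fderiv ℝ u y v) x v * w x + 2 * fderiv ℝ u x v * fderiv ℝ w x v
        + u x * fderiv ℝ (fun y => fderiv ℝ w y v) x v + 2 * fderiv ℝ h x v ^ 2
        + 2 * h x * fderiv ℝ (fun y => fderiv ℝ h y v) x v := by
  have one : ∀ y ∈ D, p y * fderiv ℝ p y v
      = 0 * p y + (1 / 2) * (fderiv ℝ u y v * w y + u y * fderiv ℝ w y v)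
        + 1 * (h y * fderiv ℝ h y v) := fun y hy => by
    have e := fderiv_apply_of_mul_eq hD hp hp
      (h := fun y => 0 * p y + 1 * (u y * w y) + 1 * (h y * h y))
      (fun y hy => by linear_combination heq y hy) hy v
    have hu' := hu.differentiableAt_of_isOpen hD hy
    have hw' := hw.differentiableAt_of_isOpen hD hy
    have hh' := hh.differentiableAt_of_isOpen hD hy
    have hp' := hp.differentiableAt_of_isOpen hD hy
    rw [fderiv_linear_combination_apply (hp'.const_mul 0) (hu'.fun_mul hw') (hh'.fun_mul hh'),
      fderiv_mul_apply hu' hw', fderiv_mul_apply hh' hh', fderiv_const_mul hp'] at e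
    simp only [zero_smul, zero_apply] at e
    linarith
  refine ⟨by linear_combination 2 * one x hx, ?_⟩
  have hu' := hu.differentiableAt_of_isOpen hD hx
  have hw' := hw.differentiableAt_of_isOpen hD hx
  have hh' := hh.differentiableAt_of_isOpen hD hx
  have hp' := hp.differentiableAt_of_isOpen hD hx
  have hu2 := (contDiffOn_fderiv_apply hD hu v).differentiableAt_of_isOpen hD hx
  have hw2 := (contDiffOn_fderiv_apply hD hw v).differentiableAt_of_isOpen hD hx
  have hh2 := (contDiffOn_fderiv_apply hD hh v).differentiableAt_of_isOpen hD hx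
  have e := fderiv_apply_of_mul_eq hD hp (contDiffOn_fderiv_apply hD hp v) one hx v
  rw [fderiv_linear_combination_apply (hp'.const_mul 0) ((hu2.fun_mul hw').fun_add (hu'.fun_mul hw2))
    (hh'.fun_mul hh2), fderiv_fun_add (hu2.fun_mul hw') (hu'.fun_mul hw2), add_apply,
    fderiv_mul_apply hu2 hw', fderiv_mul_apply hu' hw2, fderiv_mul_apply hh' hh2,
    fderiv_const_mul hp'] at e
  simp only [zero_smul, zero_apply] at e
  linear_combination 2 * e

/-- First and second directional derivatives of half the logarithm of a positive function. -/
lemma fderiv_fderiv_half_log (hD : IsOpen D) (hu : ContDiffOn ℝ (⊤ : ℕ∞) u D)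
    (hu0 : ∀ y ∈ D, 0 < u y) (hx : x ∈ D) (v : ℝ × ℝ) :
    fderiv ℝ (fun y => 1 / 2 * Real.log (u y)) x v = fderiv ℝ u x v / (2 * u x) ∧
    fderiv ℝ (fun y => fderiv ℝ (fun z => 1 / 2 * Real.log (u z)) y v) x v
      = fderiv ℝ (fun y => fderiv ℝ u y v) x v / (2 * u x)
        - fderiv ℝ u x v ^ 2 / (2 * u x ^ 2) := by
  have one : ∀ y ∈ D, fderiv ℝ (fun z => 1 / 2 * Real.log (u z)) y v
      = fderiv ℝ u y v / (2 * u y) := fun y hy => by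
    have h1 := hu.differentiableAt_of_isOpen hD hy
    have h0 := (hu0 y hy).ne'
    rw [fderiv_const_mul (h1.log h0), fderiv.log h1 h0]
    simp only [smul_apply, smul_eq_mul]
    field_simp
  refine ⟨one x hx, ?_⟩
  have hu1 := hu.differentiableAt_of_isOpen hD hx
  have h0 := hu0 x hx
  rw [fderiv_apply_congr_of_isOpen hD one hx,
    fderiv_div_apply_of_isOpen hD (contDiffOn_fderiv_apply hD hu v) (contDiffOn_const.mul hu)
      (fun y hy => mul_pos two_pos (hu0 y hy)) hx, fderiv_const_mul hu1]
  simp only [smul_apply, smul_eq_mul]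
  field_simp

/-- The directional derivative of `A' = -q / u`, and of the flux `u² ∂A' / p`. -/
lemma fderiv_flux (hD : IsOpen D) {p q : ℝ × ℝ → ℝ} (hu : ContDiffOn ℝ (⊤ : ℕ∞) u D)
    (hu0 : ∀ y ∈ D, 0 < u y) (hp : ContDiffOn ℝ (⊤ : ℕ∞) p D) (hp0 : ∀ y ∈ D, 0 < p y)
    (hq : ContDiffOn ℝ (⊤ : ℕ∞) q D) (hw : ∀ y ∈ D, w y = u y ^ 2) (hx : x ∈ D) (v : ℝ × ℝ) :
    fderiv ℝ (fun y => -q y / u y) x v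
      = (q x * fderiv ℝ u x v - u x * fderiv ℝ q x v) / u x ^ 2 ∧
    fderiv ℝ (fun y => w y / p y * fderiv ℝ (fun z => -q z / u z) y v) x v
      = (q x * fderiv ℝ (fun y => fderiv ℝ u y v) x v
          - u x * fderiv ℝ (fun y => fderiv ℝ q y v) x v) / p x
        - (q x * fderiv ℝ u x v - u x * fderiv ℝ q x v) * fderiv ℝ p x v / p x ^ 2 := by
  have one : ∀ y ∈ D, fderiv ℝ (fun z => -q z / u z) y v
      = (q y * fderiv ℝ u y v - u y * fderiv ℝ q y v) / u y ^ 2 := fun y hy => by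
    rw [fderiv_div_apply_of_isOpen hD hq.neg hu hu0 hy, fderiv_fun_neg]
    have := (hu0 y hy).ne'
    simp only [neg_apply]
    field_simp
    ring
  refine ⟨one x hx, ?_⟩
  have two : ∀ y ∈ D, w y / p y * fderiv ℝ (fun z => -q z / u z) y v
      = (q y * fderiv ℝ u y v - u y * fderiv ℝ q y v) / p y := fun y hy => by
    have := (hu0 y hy).ne'
    have := (hp0 y hy).ne'
    rw [one y hy, hw y hy]
    field_simp
  have hu' := hu.differentiableAt_of_isOpen hD hx
  have hq' := hq.differentiableAt_of_isOpen hD hx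
  have hu1 := contDiffOn_fderiv_apply hD hu v
  have hq1 := contDiffOn_fderiv_apply hD hq v
  have hu2 := hu1.differentiableAt_of_isOpen hD hx
  have hq2 := hq1.differentiableAt_of_isOpen hD hx
  rw [fderiv_apply_congr_of_isOpen hD two hx,
    fderiv_div_apply_of_isOpen hD ((hq.mul hu1).sub (hu.mul hq1)) hp hp0 hx,
    fderiv_fun_sub (hq'.fun_mul hu2) (hu'.fun_mul hq2), sub_apply,
    fderiv_mul_apply hq' hu2, fderiv_mul_apply hu' hq2]
  ring

end DirectionalDerivative

/-- The pointwise algebra behind the reduction: the field equations, in terms of the values of the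
first and second derivatives of `f' = a`, `k' = q`, `l` and `Π = p`, determine
`∂₁(∂₁u / Π) + ∂₃(∂₃u / Π) + u Σ / Π³` for `u = f', k', l`. -/
lemma reduced_equations_algebra {a q l p a1 a3 q1 q3 l1 l3 p1 p3 a11 a33 q11 q33 l11 l33 p11 p33
    κ r s S : ℝ} (ha : 0 < a) (hp : 0 < p) (hS : S = a1 * l1 + a3 * l3 + q1 ^ 2 + q3 ^ 2)
    (hpp : p ^ 2 = a * l + q ^ 2)
    (d1 : 2 * p * p1 = a1 * l + a * l1 + 2 * q * q1)
    (d3 : 2 * p * p3 = a3 * l + a * l3 + 2 * q * q3)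
    (d11 : 2 * p1 ^ 2 + 2 * p * p11 = a11 * l + 2 * a1 * l1 + a * l11 + 2 * q1 ^ 2 + 2 * q * q11)
    (d33 : 2 * p3 ^ 2 + 2 * p * p33 = a33 * l + 2 * a3 * l3 + a * l33 + 2 * q3 ^ 2 + 2 * q * q33)
    (ea : a11 / (2 * a) - a1 ^ 2 / (2 * a ^ 2) + (a33 / (2 * a) - a3 ^ 2 / (2 * a ^ 2))
      + 1 / p * (a1 / (2 * a) * p1 + a3 / (2 * a) * p3)
      + a ^ 2 / (2 * p ^ 2) * (((q * a1 - a * q1) / a ^ 2) ^ 2 + ((q * a3 - a * q3) / a ^ 2) ^ 2)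
      = κ / 2 * (r + 3 * s))
    (eb : (q * a11 - a * q11) / p - (q * a1 - a * q1) * p1 / p ^ 2
      + ((q * a33 - a * q33) / p - (q * a3 - a * q3) * p3 / p ^ 2) = 0)
    (ec : p11 + p33 = 2 * κ * s * p) :
    p * (a11 / p - a1 * p1 / p ^ 2 + (a33 / p - a3 * p3 / p ^ 2) + a * S / p ^ 3)
        = κ * a * (r + 3 * s) ∧
    p * (q11 / p - q1 * p1 / p ^ 2 + (q33 / p - q3 * p3 / p ^ 2) + q * S / p ^ 3)
        = κ * q * (r + 3 * s) ∧
    p * (l11 / p - l1 * p1 / p ^ 2 + (l33 / p - l3 * p3 / p ^ 2) + l * S / p ^ 3)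
        = -(κ * ((r + s) * (p ^ 2 + q ^ 2) / a - 2 * s * l)) := by
  have ha' := ha.ne'
  have hp' := hp.ne'
  have hS' : a ^ 2 * S = 2 * a * p * (a1 * p1 + a3 * p3) - p ^ 2 * (a1 ^ 2 + a3 ^ 2)
      + (q * a1 - a * q1) ^ 2 + (q * a3 - a * q3) ^ 2 := by
    linear_combination a ^ 2 * hS - a * a1 * d1 - a * a3 * d3 + (a1 ^ 2 + a3 ^ 2) * hpp
  have hSd : S = (2 * a * p * (a1 * p1 + a3 * p3) - p ^ 2 * (a1 ^ 2 + a3 ^ 2)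
      + (q * a1 - a * q1) ^ 2 + (q * a3 - a * q3) ^ 2) / a ^ 2 := by
    field_simp
    linarith
  have e1 : p * (a11 / p - a1 * p1 / p ^ 2 + (a33 / p - a3 * p3 / p ^ 2) + a * S / p ^ 3)
        = κ * a * (r + 3 * s) := by
    trans 2 * a * (κ / 2 * (r + 3 * s))
    · rw [← ea, hSd]
      field_simp
      ring
    · ring
  have e2 : p * (q11 / p - q1 * p1 / p ^ 2 + (q33 / p - q3 * p3 / p ^ 2) + q * S / p ^ 3)
        = κ * q * (r + 3 * s) := by
    apply mul_left_cancel₀ ha'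
    linear_combination q * e1 - p * eb
  refine ⟨e1, e2, ?_⟩
  have e3 : l * (p * (a11 / p - a1 * p1 / p ^ 2 + (a33 / p - a3 * p3 / p ^ 2) + a * S / p ^ 3))
      + a * (p * (l11 / p - l1 * p1 / p ^ 2 + (l33 / p - l3 * p3 / p ^ 2) + l * S / p ^ 3))
      + 2 * q * (p * (q11 / p - q1 * p1 / p ^ 2 + (q33 / p - q3 * p3 / p ^ 2) + q * S / p ^ 3))
      = 2 * p * (p11 + p33) := by
    trans (a11 + a33) * l + a * (l11 + l33) + 2 * q * (q11 + q33)
      - (p1 * (a1 * l + a * l1 + 2 * q * q1) + p3 * (a3 * l + a * l3 + 2 * q * q3)) / p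
      + 2 * (a * l + q ^ 2) * S / p ^ 2
    · field_simp
      ring
    · rw [← d1, ← d3, ← hpp]
      field_simp
      linear_combination 2 * hS - d11 - d33
  rw [e1, e2, ec] at e3
  apply mul_left_cancel₀ ha'
  have e4 : a * -(κ * ((r + s) * (p ^ 2 + q ^ 2) / a - 2 * s * l))
      = -(κ * ((r + s) * (p ^ 2 + q ^ 2) - 2 * s * l * a)) := by
    field_simp
  rw [e4]
  linear_combination e3 + κ * (r + 5 * s) * hpp

/-- Proposition B: the three reduced field equations (EAa), (EAb), (EAc) imply
the (00), (02), (22) Einstein equations. -/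
theorem reduced_field_equations_imp_einstein
    (D : Set (ℝ × ℝ)) (hD : IsOpen D) (hDconn : IsConnected D)
    (Ω c G : ℝ) (hc : 0 < c) (hG : 0 < G)
    (f k l m ρ P : ℝ × ℝ → ℝ)
    (hf : ContDiffOn ℝ (⊤ : ℕ∞) f D) (hk : ContDiffOn ℝ (⊤ : ℕ∞) k D) (hl : ContDiffOn ℝ (⊤ : ℕ∞) l D)
    (hm : ContDiffOn ℝ (⊤ : ℕ∞) m D) (hρ : ContDiffOn ℝ (⊤ : ℕ∞) ρ D) (hP : ContDiffOn ℝ (⊤ : ℕ∞) P D)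
    (hpos : ∀ x ∈ D, 0 < f x * l x + (k x) ^ 2)
    (hfP : ∀ x ∈ D, 0 < fP Ω c f k l x)
    (ha : ∀ x ∈ D, EAa Ω c G f k l m ρ P x)
    (hb : ∀ x ∈ D, EAb Ω c f k l x)
    (hcc : ∀ x ∈ D, EAc Ω c G f k l m P x) :
    ∀ x ∈ D,
      R00 f k l m x = (8 * π * G / c ^ 4) * T00 Ω c f k l ρ P x ∧
      R02 f k l m x = (8 * π * G / c ^ 4) * T02 Ω c f k l ρ P x ∧
      R22 f k l m x = (8 * π * G / c ^ 4) * T22 Ω c f k l ρ P x := by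
  have hpSq : ∀ y ∈ D, PiF f k l y ^ 2 = fP Ω c f k l y * l y + kP Ω c k l y ^ 2 := fun y hy => by
    rw [PiF, Real.sq_sqrt (hpos y hy).le, fP, kP]
    ring
  have hpPos : ∀ y ∈ D, 0 < PiF f k l y := fun y hy => Real.sqrt_pos.2 (hpos y hy)
  have sP : ContDiffOn ℝ (⊤ : ℕ∞) (PiF f k l) D :=
    ((hf.mul hl).add (hk.pow 2)).sqrt fun y hy => (hpos y hy).ne'
  have sψ : ContDiffOn ℝ (⊤ : ℕ∞) (fP Ω c f k l) D :=
    (hf.sub (contDiffOn_const.mul hk)).sub (contDiffOn_const.mul hl)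
  have sk : ContDiffOn ℝ (⊤ : ℕ∞) (kP Ω c k l) D := hk.add (contDiffOn_const.mul hl)
  have hexp : ∀ y ∈ D, Real.exp (4 * FP Ω c f k l y) = fP Ω c f k l y ^ 2 := fun y hy => by
    rw [FP, show 4 * (1 / 2 * Real.log (fP Ω c f k l y))
      = Real.log (fP Ω c f k l y) + Real.log (fP Ω c f k l y) by ring, Real.exp_add,
      Real.exp_log (hfP y hy), pow_two]
  intro x hx
  have hexpm : Real.exp (-2 * FP Ω c f k l x + 2 * KP Ω c f k l m x) = Real.exp (m x) := by
    rw [KP]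
    ring_nf
  have d1 := fderiv_fderiv_of_sq_eq hD sP sψ hl sk hpSq hx (1, 0)
  have d3 := fderiv_fderiv_of_sq_eq hD sP sψ hl sk hpSq hx (0, 1)
  have F1 := fderiv_fderiv_half_log hD sψ hfP hx (1, 0)
  have F3 := fderiv_fderiv_half_log hD sψ hfP hx (0, 1)
  have A1 := fderiv_flux hD sψ hfP sP hpPos sk hexp hx (1, 0)
  have A3 := fderiv_flux hD sψ hfP sP hpPos sk hexp hx (0, 1)
  have f1 := fderiv_fderiv_linear_combination_apply hD sψ sk hl (2 * (Ω / c)) (-(Ω ^ 2 / c ^ 2))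
    (u := f) (fun y _ => by rw [fP, kP]; ring) hx (1, 0)
  have f3 := fderiv_fderiv_linear_combination_apply hD sψ sk hl (2 * (Ω / c)) (-(Ω ^ 2 / c ^ 2))
    (u := f) (fun y _ => by rw [fP, kP]; ring) hx (0, 1)
  have k1 := fderiv_fderiv_linear_combination_apply hD sk hl hl (-(Ω / c)) 0
    (u := k) (fun y _ => by rw [kP]; ring) hx (1, 0)
  have k3 := fderiv_fderiv_linear_combination_apply hD sk hl hl (-(Ω / c)) 0
    (u := k) (fun y _ => by rw [kP]; ring) hx (0, 1)
  have quot : ∀ u : ℝ × ℝ → ℝ, ContDiffOn ℝ (⊤ : ℕ∞) u D → ∀ v : ℝ × ℝ,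
      fderiv ℝ (fun y => fderiv ℝ u y v / PiF f k l y) x v
        = fderiv ℝ (fun y => fderiv ℝ u y v) x v / PiF f k l x
          - fderiv ℝ u x v * fderiv ℝ (PiF f k l) x v / PiF f k l x ^ 2 := fun u hu v =>
    fderiv_div_apply_of_isOpen hD (contDiffOn_fderiv_apply hD hu v) sP hpPos hx v
  have hψx := hfP x hx
  have hpx := hpPos x hx
  have hE : Real.exp (-(m x)) * Real.exp (m x) = 1 := by rw [← Real.exp_add]; simp
  have ea := ha x hx
  have eb := hb x hx
  have ec := hcc x hx
  have hfx : f x = fP Ω c f k l x + 2 * (Ω / c) * kP Ω c k l x + -(Ω ^ 2 / c ^ 2) * l x := by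
    rw [fP, kP]; ring
  have hkx : k x = kP Ω c k l x + -(Ω / c) * l x := by rw [kP]; ring
  have hpd1 : pd1 = fun u y => fderiv ℝ u y (1, 0) := rfl
  have hpd3 : pd3 = fun u y => fderiv ℝ u y (0, 1) := rfl
  simp only [EAa, EAb, EAc, hpd1, hpd3] at ea eb ec
  rw [hexp x hx, hexpm] at ea
  rw [hexpm] at ec
  change fderiv ℝ (FP Ω c f k l) x _ = _ ∧
    fderiv ℝ (fun y => fderiv ℝ (FP Ω c f k l) y _) x _ = _ at F1 F3
  change fderiv ℝ (AP Ω c f k l) x _ = _ ∧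
    fderiv ℝ (fun y => _ * fderiv ℝ (AP Ω c f k l) y _) x _ = _ at A1 A3
  rw [F1.2, F3.2, F1.1, F3.1, A1.1, A3.1] at ea
  rw [A1.2, A3.2] at eb
  obtain ⟨Lψ, Lq, Ll⟩ := reduced_equations_algebra
    (κ := 8 * π * G / c ^ 4 * Real.exp (m x)) (r := c ^ 2 * ρ x) (s := P x) (S := SigF f k l x)
    hψx hpx (by simp only [SigF, hpd1, hpd3]; rw [f1.1, f3.1, k1.1, k3.1]; ring) (hpSq x hx) d1.1 d3.1 d1.2 d3.2
    (by linear_combination ea) eb (by linear_combination ec)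
  have hpp := hpSq x hx
  have t00 : T00 Ω c f k l ρ P x = (fP Ω c f k l x * (c ^ 2 * ρ x + 3 * P x)
      + 2 * (Ω / c) * (kP Ω c k l x * (c ^ 2 * ρ x + 3 * P x))
      + (Ω ^ 2 / c ^ 2) * ((c ^ 2 * ρ x + P x) * (PiF f k l x ^ 2 + kP Ω c k l x ^ 2)
        / fP Ω c f k l x - 2 * P x * l x)) / 2 := by
    rw [T00, hfx, hkx]
    field_simp
    ring
  have t02 : T02 Ω c f k l ρ P x = -(kP Ω c k l x * (c ^ 2 * ρ x + 3 * P x)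
      + (Ω / c) * ((c ^ 2 * ρ x + P x) * (PiF f k l x ^ 2 + kP Ω c k l x ^ 2)
        / fP Ω c f k l x - 2 * P x * l x)) / 2 := by
    rw [T02, hfx, hkx, hpp]
    field_simp
    ring
  have t22 : T22 Ω c f k l ρ P x = ((c ^ 2 * ρ x + P x) * (PiF f k l x ^ 2 + kP Ω c k l x ^ 2)
        / fP Ω c f k l x - 2 * P x * l x) / 2 := by
    rw [T22, hkx]
    field_simp
    ring
  refine ⟨?_, ?_, ?_⟩
  · rw [t00]
    simp only [R00, hpd1, hpd3]
    rw [quot f hf, quot f hf, f1.1, f1.2, f3.1, f3.2, hfx]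
    linear_combination Real.exp (-(m x)) / 2 * (Lψ + 2 * (Ω / c) * Lq - Ω ^ 2 / c ^ 2 * Ll)
      + 8 * π * G / c ^ 4 * ((fP Ω c f k l x * (c ^ 2 * ρ x + 3 * P x)
      + 2 * (Ω / c) * (kP Ω c k l x * (c ^ 2 * ρ x + 3 * P x))
      + (Ω ^ 2 / c ^ 2) * ((c ^ 2 * ρ x + P x) * (PiF f k l x ^ 2 + kP Ω c k l x ^ 2)
        / fP Ω c f k l x - 2 * P x * l x)) / 2) * hE
  · rw [t02]
    simp only [R02, hpd1, hpd3]
    rw [quot k hk, quot k hk, k1.1, k1.2, k3.1, k3.2, hkx]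
    linear_combination -Real.exp (-(m x)) / 2 * (Lq - Ω / c * Ll)
      - 8 * π * G / c ^ 4 * ((kP Ω c k l x * (c ^ 2 * ρ x + 3 * P x)
      + (Ω / c) * ((c ^ 2 * ρ x + P x) * (PiF f k l x ^ 2 + kP Ω c k l x ^ 2)
        / fP Ω c f k l x - 2 * P x * l x)) / 2) * hE
  · rw [t22]
    simp only [R22, hpd1, hpd3]
    rw [quot l hl, quot l hl]
    linear_combination -Real.exp (-(m x)) / 2 * Ll
      + 8 * π * G / c ^ 4 * (((c ^ 2 * ρ x + P x) * (PiF f k l x ^ 2 + kP Ω c k l x ^ 2)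
        / fP Ω c f k l x - 2 * P x * l x) / 2) * hE
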